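/- arXiv:2208.09348 — 19 statements merged into one kernel-verified Lean document; each statement's English description precedes it below -/
import Mathlib

section
/- Let a, b, c, d be real numbers with 0 < c < a and 0 < d < b. Then it is not the case that S101 is strictly greater than both S1 and S001; equivalently, S101 <= max(S1, S001). (Strategy 10|1 is never optimal in the two-user system.) -/
noncomputable def S1 (a b : ℝ) : ℝ := (2*b^2 + 2*a*b)/(2*a*b + 2*a^2 + b^2)

noncomputable def S0 (c d : ℝ) : ℝ := (2*d^2 + 2*c*d)/(2*c*d + 2*c^2 + d^2)

noncomputable def S001 (a b c d : ℝ) : ℝ :=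
  (2*a*b*d^2 + 4*b*c^2*d + 2*a*b*c*d + 2*b*c^2*(a + c))/
    (2*c^2*(a + b)*(a + c) + 2*c*d*(b*c + a*(b + c)) + a*b*d^2)

noncomputable def S101 (a b c d : ℝ) : ℝ :=
  (2*b*d*(b + c) + a*b*d + b*c*(a + b + c))/((a + b)*((c + d)*(b + c) + a*c))

noncomputable def S100 (a b c d : ℝ) : ℝ :=
  (2*b*d*(a + d) + a*d*(a + c + d) + b*c*d)/((c + d)*(a*(a + b + c) + d*(a + b)))

noncomputable def S110 (a b c d : ℝ) : ℝ :=
  (4*a^2*b*d + 2*b^2*c*d + 2*a^2*d*(a + c) + 2*a*b*c*d)/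
    (2*a^3*(c + d) + 2*a^2*(c + d)*(b + c) + 2*a*b*c*d + b^2*c*d)

/-- The cross-multiplied conditions for `10|1` to beat `*1|1` and `00|1` are incompatible. -/
lemma not_S101_beats_both {a b c d : ℝ} (hb : 0 < b) (hc : 0 < c) (hca : c < a) (hd : 0 < d)
    (h₁ : (b * c - a * d) * ((a + b + c) * (2 * a + b)) < a * b * d * (a - c))
    (h₂ : b * c * d * (a - c) <
      (b * c - a * d) * (2 * c * (a + b + c) + d * (b + 2 * c))) : False := by
  have ha : 0 < a := hc.trans hca
  have hD : 0 < b * c - a * d := by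
    have hk : 0 < b * c * d * (a - c) := mul_pos (by positivity) (sub_pos.2 hca)
    exact pos_of_mul_pos_left (hk.trans h₂) (by positivity)
  have hYZ : a * (2 * c * (a + b + c) + d * (b + 2 * c)) ≤ c * ((a + b + c) * (2 * a + b)) := by
    have h₃ : 0 ≤ (b * c - a * d) * (b + 2 * c) := by positivity
    have h₄ : 0 ≤ b * c * (a - c) := mul_nonneg (by positivity) (sub_nonneg.2 hca.le)
    linarith
  have h₅ := mul_le_mul_of_nonneg_left hYZ hD.le
  have h₆ := mul_lt_mul_of_pos_left h₁ hc
  have h₇ := mul_lt_mul_of_pos_left h₂ ha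
  linarith

theorem S101_never_optimal (a b c d : ℝ) (hc : 0 < c) (hca : c < a)
    (hd : 0 < d) (hdb : d < b) :
    S101 a b c d ≤ max (S1 a b) (S001 a b c d) := by
  have ha : 0 < a := hc.trans hca
  have hb : 0 < b := hd.trans hdb
  by_contra! h
  obtain ⟨h₁, h₂⟩ := max_lt_iff.1 h
  unfold S1 S101 at h₁
  unfold S001 S101 at h₂
  rw [div_lt_div_iff₀ (by positivity) (by positivity)] at h₁ h₂
  refine not_S101_beats_both hb hc hca hd (lt_of_mul_lt_mul_left ?_ hb.le)
    (lt_of_mul_lt_mul_left ?_ (by positivity : 0 ≤ a * b * d))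
  · linarith
  · linarith
end

section
/- Let a, b, c, d be real numbers with 0 < c < a and 0 < d < b. Then it is not the case that S100 is strictly greater than both S0 and S101; equivalently, S100 <= max(S0, S101). (Strategy 10|0 is never optimal in the two-user system.) -/
/-- After clearing denominators, the hypothesis says `S0 ≤ S100` and the conclusion `S100 ≤ S101`.
The cubic in `b` is expanded around the point where the hypothesis is an equality; all
coefficients of this expansion are nonpositive. -/
lemma cubic_nonpos_of_S0_threshold_le (a b c d : ℝ) (hc : 0 < c) (hca : c < a) (hd : 0 < d)
    (h : a * d * (2*a*c + a*d + 2*c^2 + 3*c*d + d^2) ≤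
      b * (c * (2*a*c + 2*c^2 + 4*c*d + d^2))) :
    -(c + d) * b^3 + -(2*a*c + 2*c^2 + 3*c*d) * b^2
      + (-a^2*c + 2*a^2*d - 2*a*c^2 + 3*a*d^2 - c^3 - 2*c^2*d + d^3) * b
      + (a^3*d + 2*a^2*c*d + 2*a^2*d^2 + a*c^2*d + 2*a*c*d^2 + a*d^3) ≤ 0 := by
  obtain ⟨x, hx, rfl⟩ : ∃ x, 0 < x ∧ a = c + x := ⟨a - c, sub_pos.2 hca, by ring⟩
  set A := (c + x) * d * (2*(c + x)*c + (c + x)*d + 2*c^2 + 3*c*d + d^2) with hA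
  set B := c * (2*(c + x)*c + 2*c^2 + 4*c*d + d^2) with hB
  set q₃ := -(c + d) with hq₃
  set q₂ := -(2*(c + x)*c + 2*c^2 + 3*c*d) with hq₂
  set q₁ := -(c + x)^2*c + 2*(c + x)^2*d - 2*(c + x)*c^2 + 3*(c + x)*d^2 - c^3 - 2*c^2*d + d^3
    with hq₁
  set q₀ := (c + x)^3*d + 2*(c + x)^2*c*d + 2*(c + x)^2*d^2 + (c + x)*c^2*d + 2*(c + x)*c*d^2
    + (c + x)*d^3 with hq₀
  have hBpos : 0 < B := by positivity
  have hr₀ : 0 ≤ -(q₃ * A^3 + q₂ * A^2 * B + q₁ * A * B^2 + q₀ * B^3) := by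
    rw [hA, hB, hq₃, hq₂, hq₁, hq₀]; ring_nf; positivity
  have hr₁ : 0 ≤ -(3 * q₃ * A^2 + 2 * q₂ * A * B + q₁ * B^2) := by
    rw [hA, hB, hq₃, hq₂, hq₁]; ring_nf; positivity
  have hr₂ : 0 ≤ -(3 * q₃ * A + q₂ * B) := by
    rw [hA, hB, hq₃, hq₂]; ring_nf; positivity
  have hr₃ : 0 ≤ -q₃ := by rw [hq₃]; linarith
  obtain ⟨t, ht, hbt⟩ : ∃ t, 0 ≤ t ∧ b * B = A + t := ⟨b * B - A, sub_nonneg.2 h, by ring⟩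
  clear_value A B q₃ q₂ q₁ q₀
  have expansion : B^3 * -(q₃ * b^3 + q₂ * b^2 + q₁ * b + q₀) =
      -(q₃ * A^3 + q₂ * A^2 * B + q₁ * A * B^2 + q₀ * B^3)
        + -(3 * q₃ * A^2 + 2 * q₂ * A * B + q₁ * B^2) * t
        + -(3 * q₃ * A + q₂ * B) * t^2 + -q₃ * t^3 := by
    obtain rfl : A = b * B - t := by linarith
    ring
  have hnonneg : 0 ≤ B^3 * -(q₃ * b^3 + q₂ * b^2 + q₁ * b + q₀) := by
    rw [expansion]; positivity
  exact neg_nonneg.1 (nonneg_of_mul_nonneg_right hnonneg (pow_pos hBpos 3))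

theorem S100_never_optimal (a b c d : ℝ) (hc : 0 < c) (hca : c < a)
    (hd : 0 < d) (hdb : d < b) :
    S100 a b c d ≤ max (S0 c d) (S101 a b c d) := by
  have ha : 0 < a := hc.trans hca
  have hb : 0 < b := hd.trans hdb
  rw [le_max_iff]
  rcases le_total (b * (c * (2*a*c + 2*c^2 + 4*c*d + d^2)))
    (a * d * (2*a*c + a*d + 2*c^2 + 3*c*d + d^2)) with h | h
  · left
    rw [S100, S0, div_le_div_iff₀ (by positivity) (by positivity)]
    linear_combination d * h
  · right
    rw [S100, S101, div_le_div_iff₀ (by positivity) (by positivity)]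
    linear_combination (a * c) * cubic_nonpos_of_S0_threshold_le a b c d hc hca hd h
end

section
/- Let a, b, c, d be real numbers with 0 < c < a and 0 < d < b. Then it is not the case that S110 is strictly greater than both S100 and S1; equivalently, S110 <= max(S100, S1). (Strategy 11|0 is never optimal in the two-user system.) -/
theorem S110_le_S1 {a b c d : ℝ} (ha : 0 < a) (hb : 0 < b) (hc : 0 < c) (hd : 0 < d)
    (h : d * (a * (2*a^2 + 4*a*b + b^2) + c * (2*a^2 + 2*a*b + b^2)) ≤
      2*b*c*(a + b)*(a + b + c)) :
    S110 a b c d ≤ S1 a b := by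
  unfold S110 S1
  rw [div_le_div_iff₀ (by positivity) (by positivity)]
  linear_combination 2 * a^2 * h

theorem S110_le_S100 {a b c d : ℝ} (hb : 0 < b) (hc : 0 < c) (hca : c < a) (hd : 0 < d)
    (h : 2*b*c*(a + b)*(a + b + c) ≤
      d * (a * (2*a^2 + 4*a*b + b^2) + c * (2*a^2 + 2*a*b + b^2))) :
    S110 a b c d ≤ S100 a b c d := by
  have ha : 0 < a := hc.trans hca
  have hac : 0 < a - c := sub_pos.2 hca
  have hX : 0 < a * (2*a^2 + 4*a*b + b^2) + c * (2*a^2 + 2*a*b + b^2) := by positivity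
  have hW : 0 ≤ a*(2*a + b)*(a + b)*d + a^2*b*(a + 2*b) - c*b*(3*a^2 + 5*a*b + b^2) := by
    refine nonneg_of_mul_nonneg_right ?_ hX
    have hmain := mul_nonneg (by positivity : 0 ≤ a*(2*a + b)*(a + b)) (sub_nonneg.2 h)
    have hrest : 0 ≤ b*(a - c)*(a^2*(2*a^3 + 8*a^2*b + 9*a*b^2 + 2*b^3) +
        c*(2*a^4 + 6*a^3*b + 7*a^2*b^2 + 5*a*b^3 + b^4)) := by positivity
    linear_combination hmain + hrest
  unfold S110 S100
  rw [div_le_div_iff₀ (by positivity) (by positivity)]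
  refine le_of_mul_le_mul_left ?_ (add_pos ha hb)
  have hdW := mul_nonneg (by positivity : 0 ≤ b*c*d*d) hW
  have hgap := mul_nonneg (by positivity : 0 ≤ b*c*d*a) (sub_nonneg.2 h)
  linear_combination hdW + hgap

theorem S110_never_optimal (a b c d : ℝ) (hc : 0 < c) (hca : c < a)
    (hd : 0 < d) (hdb : d < b) :
    S110 a b c d ≤ max (S100 a b c d) (S1 a b) := by
  have hb : 0 < b := hd.trans hdb
  rcases le_total (2*b*c*(a + b)*(a + b + c))
      (d * (a * (2*a^2 + 4*a*b + b^2) + c * (2*a^2 + 2*a*b + b^2))) with h | h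
  · exact le_max_of_le_left (S110_le_S100 hb hc hca hd h)
  · exact le_max_of_le_right (S110_le_S1 (hc.trans hca) hb hc hd h)
end

section
/- Let b, c, d be real numbers with 0 < d < b and 0 < c, and set a = b*c/d (so that the two service types are equally efficient, a/b = c/d). Then S001 > S0 and S001 > S1. -/
/-- The efficiency of a constant strategy depends only on the ratio `r` of the activity rate to the
service rate. -/
theorem S1_ratio_mul {b : ℝ} (r : ℝ) (hb : b ≠ 0) :
    S1 (b * r) b = (2 + 2 * r) / (1 + 2 * r + 2 * r ^ 2) := by
  unfold S1
  rw [← mul_div_mul_left _ (1 + 2 * r + 2 * r ^ 2) (pow_ne_zero 2 hb)]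
  congr 1 <;> ring

theorem S0_eq_S1 (c d : ℝ) : S0 c d = S1 c d := rfl

theorem S001_ratio_mul {b d r : ℝ} (hb : b ≠ 0) (hd : d ≠ 0) (hr : r ≠ 0) :
    S001 (b * r) b (d * r) d =
      2 * (b + 2 * d * r + b * r + r ^ 2 * (b + d)) /
        (2 * r ^ 2 * (r + 1) * (b + d) + 2 * r * (b + d + d * r) + b) := by
  unfold S001
  rw [← mul_div_mul_left _ (2 * r ^ 2 * (r + 1) * (b + d) + 2 * r * (b + d + d * r) + b)
    (mul_ne_zero (mul_ne_zero hb (pow_ne_zero 2 hd)) hr)]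
  congr 1 <;> ring

theorem lt_S001_ratio_mul {b d r : ℝ} (hd : 0 < d) (hdb : d < b) (hr : 0 < r) :
    (2 + 2 * r) / (1 + 2 * r + 2 * r ^ 2) < S001 (b * r) b (d * r) d := by
  have hb : 0 < b := hd.trans hdb
  rw [S001_ratio_mul hb.ne' hd.ne' hr.ne', div_lt_div_iff₀ (by positivity) (by positivity)]
  have h : 0 < r ^ 2 * (b - d) := mul_pos (by positivity) (sub_pos.2 hdb)
  linear_combination 2 * h

theorem S001_optimal_on_equal_efficiency_line (b c d : ℝ)
    (hd : 0 < d) (hdb : d < b) (hc : 0 < c) :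
    S001 (b*c/d) b c d > S0 c d ∧ S001 (b*c/d) b c d > S1 (b*c/d) b := by
  have hb : 0 < b := hd.trans hdb
  obtain ⟨r, rfl⟩ : ∃ r, c = d * r := ⟨c / d, by field_simp⟩
  have hr : 0 < r := pos_of_mul_pos_right hc hd.le
  have ha : b * (d * r) / d = b * r := by field_simp
  rw [ha, S0_eq_S1, S1_ratio_mul r hd.ne', S1_ratio_mul r hb.ne']
  exact ⟨lt_S001_ratio_mul hd hdb hr, lt_S001_ratio_mul hd hdb hr⟩
end

section
/- Let b, c, d be real numbers with 0 < d < b and 0 < c, and set a = b*c/d. Then S001 is strictly greater than each of S1, S0, S101, S100 and S110; that is, on the line where the two service types are equally efficient, strategy 00|1 is the strictly optimal pure strategy among the six representative strategies of the two-user system. -/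
theorem S001_strictly_optimal_on_equal_efficiency_line (b c d : ℝ)
    (hd : 0 < d) (hdb : d < b) (hc : 0 < c) :
    S001 (b*c/d) b c d > S1 (b*c/d) b ∧
    S001 (b*c/d) b c d > S0 c d ∧
    S001 (b*c/d) b c d > S101 (b*c/d) b c d ∧
    S001 (b*c/d) b c d > S100 (b*c/d) b c d ∧
    S001 (b*c/d) b c d > S110 (b*c/d) b c d := by
  obtain ⟨t, rfl⟩ : ∃ t, b = (1 + t) * d := ⟨b / d - 1, by field_simp; ring⟩
  have ht : 0 < t := by nlinarith
  have ha : (1 + t) * d * c / d = (1 + t) * c := by field_simp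
  rw [ha]
  simp only [S1, S0, S001, S101, S100, S110, gt_iff_lt]
  refine ⟨?_, ?_, ?_, ?_, ?_⟩ <;>
  · rw [div_lt_div_iff₀ (by positivity) (by positivity), ← sub_pos]
    ring_nf
    positivity
end

section
/- Fix real numbers b, c, d > 0 and regard S0 and S001 as functions of a on (0, infinity). Then there exists a unique f* > 0 such that for every a > 0: S0(a) > S001(a) if a > f*, S0(a) < S001(a) if a < f*, and S0(a) = S001(a) if a = f*. (Existence and uniqueness of the switching threshold between strategies 0*|0 and 00|1.) -/
/-- A real quadratic with positive leading and negative constant coefficient has a positive root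
whose complementary linear factor is positive on the positive half-line. -/
theorem exists_pos_root_quadratic {A C : ℝ} (B : ℝ) (hA : 0 < A) (hC : C < 0) :
    ∃ f : ℝ, 0 < f ∧ ∀ a : ℝ, A * a ^ 2 + B * a + C = (a - f) * (A * a - C / f) := by
  have hAC : 0 < -(A * C) := by nlinarith
  set s := √(B ^ 2 - 4 * A * C)
  have hss : s ^ 2 = B ^ 2 - 4 * A * C := Real.sq_sqrt (by nlinarith [sq_nonneg B])
  have hBs : B < s := Real.lt_sqrt_of_sq_lt (by linarith)
  have hpos : 0 < (s - B) / (2 * A) := div_pos (by linarith) (by linarith)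
  refine ⟨(s - B) / (2 * A), hpos, fun a => ?_⟩
  have hroot : A * ((s - B) / (2 * A)) ^ 2 + B * ((s - B) / (2 * A)) + C = 0 := by
    field_simp
    linear_combination hss
  generalize (s - B) / (2 * A) = f at hpos hroot
  have hf : f ≠ 0 := hpos.ne'
  field_simp
  linear_combination a * hroot

/-- The difference of the two efficiencies is a quadratic in `a` over a positive denominator. -/
theorem S0_sub_S001 {a b c d : ℝ} (ha : 0 < a) (hb : 0 < b) (hc : 0 < c) (hd : 0 < d) :
    S0 c d - S001 a b c d =
      (4 * c ^ 2 * d * (c + d) * a ^ 2 +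
        (2 * d * (c + d) * (2 * c * (c + d) * (b + c) + b * d ^ 2) -
          2 * b * (d ^ 2 + c * d + c ^ 2) * (2 * c * d + 2 * c ^ 2 + d ^ 2)) * a +
        -(2 * b * c ^ 3 * (2 * c ^ 2 + 4 * c * d + d ^ 2))) /
      ((2*c*d + 2*c^2 + d^2) *
        (2*c^2*(a + b)*(a + c) + 2*c*d*(b*c + a*(b + c)) + a*b*d^2)) := by
  have h₀ : 2*c*d + 2*c^2 + d^2 ≠ 0 := by positivity
  have h₁ : 2*c^2*(a + b)*(a + c) + 2*c*d*(b*c + a*(b + c)) + a*b*d^2 ≠ 0 := by positivity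
  rw [S0, S001, div_sub_div _ _ h₀ h₁]
  congr 1
  ring

theorem switching_threshold_S0_S001 (b c d : ℝ) (hb : 0 < b) (hc : 0 < c) (hd : 0 < d) :
    ∃! f : ℝ, 0 < f ∧ ∀ a : ℝ, 0 < a →
      ((f < a → S0 c d > S001 a b c d) ∧
       (a < f → S0 c d < S001 a b c d) ∧
       (a = f → S0 c d = S001 a b c d)) := by
  obtain ⟨f, hf, hfac⟩ := exists_pos_root_quadratic
    (A := 4 * c ^ 2 * d * (c + d)) (C := -(2 * b * c ^ 3 * (2 * c ^ 2 + 4 * c * d + d ^ 2)))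
    (2 * d * (c + d) * (2 * c * (c + d) * (b + c) + b * d ^ 2) -
      2 * b * (d ^ 2 + c * d + c ^ 2) * (2 * c * d + 2 * c ^ 2 + d ^ 2))
    (by positivity) (neg_neg_of_pos (by positivity))
  have key : ∀ a : ℝ, 0 < a → ∃ k : ℝ, 0 < k ∧ S0 c d - S001 a b c d = (a - f) * k := by
    intro a ha
    refine ⟨_, ?_, by rw [S0_sub_S001 ha hb hc hd, hfac, mul_div_assoc]⟩
    rw [neg_div, sub_neg_eq_add]
    positivity
  refine ⟨f, ⟨hf, fun a ha => ?_⟩, fun g ⟨hg, h⟩ => ?_⟩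
  · obtain ⟨k, hk, e⟩ := key a ha
    refine ⟨fun h => ?_, fun h => ?_, fun h => ?_⟩
    · have := mul_pos (sub_pos.2 h) hk
      linarith
    · have := mul_neg_of_neg_of_pos (sub_neg.2 h) hk
      linarith
    · rw [h, sub_self, zero_mul] at e
      rw [h]
      exact sub_eq_zero.1 e
  · obtain ⟨k, hk, e⟩ := key g hg
    rw [(h g hg).2.2 rfl, sub_self, eq_comm, mul_eq_zero] at e
    exact sub_eq_zero.1 (e.resolve_right hk.ne')
end

section
/- Fix real numbers b, c, d > 0 and regard S1 and S001 as functions of a on (0, infinity). Then there exists a unique g* > 0 such that for every a > 0: S1(a) > S001(a) if a < g*, S1(a) < S001(a) if a > g*, and S1(a) = S001(a) if a = g*. (Existence and uniqueness of the switching threshold between strategies *1|1 and 00|1.) -/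
/-- A real cubic whose coefficients have signs `-, ?, +, +` changes sign exactly once
on the positive half-line. -/
theorem exists_pos_cubic_sign_change {A B C E : ℝ} (hA : 0 < A) (hC : 0 < C) (hE : 0 < E) :
    ∃ g : ℝ, 0 < g ∧ ∃ k : ℝ → ℝ, ∀ a : ℝ, 0 < a →
      0 < k a ∧ -A * a ^ 3 + B * a ^ 2 + C * a + E = (g - a) * k a := by
  obtain ⟨M, hM, hAM⟩ : ∃ M : ℝ, 1 ≤ M ∧ A * M = A + |B| + C + E :=
    ⟨1 + (|B| + C + E) / A, by
      have : 0 ≤ (|B| + C + E) / A := by positivity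
      linarith, by field_simp; ring⟩
  have hM_neg : -A * M ^ 3 + B * M ^ 2 + C * M + E ≤ 0 := by
    have h₁ : -A * M ^ 3 = -(A + |B| + C + E) * M ^ 2 := by rw [← hAM]; ring
    have h₂ : B * M ^ 2 ≤ |B| * M ^ 2 := by gcongr; exact le_abs_self B
    have h₃ : C * M ≤ C * M ^ 2 := by gcongr; nlinarith
    have h₄ : E * 1 ≤ E * M ^ 2 := by gcongr; nlinarith
    have h₅ : 0 ≤ A * M ^ 2 := by positivity
    linarith
  obtain ⟨g, ⟨hg₀, -⟩, hg⟩ := intermediate_value_Icc' (zero_le_one.trans hM)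
    (f := fun a : ℝ => -A * a ^ 3 + B * a ^ 2 + C * a + E) (by fun_prop)
    (show (0 : ℝ) ∈ Set.Icc _ _ from ⟨hM_neg, by norm_num; exact hE.le⟩)
  have hg_root : -A * g ^ 3 + B * g ^ 2 + C * g + E = 0 := hg
  have hg_pos : 0 < g := by
    refine lt_of_le_of_ne hg₀ ?_
    rintro rfl
    norm_num at hg_root
    exact hE.ne' hg_root
  refine ⟨g, hg_pos, fun a => (A * a ^ 2 * g ^ 2 + C * a * g + E * (a + g)) / g ^ 2,
    fun a ha => ⟨by positivity, ?_⟩⟩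
  field_simp
  linear_combination a ^ 2 * hg_root

theorem S1_sub_S001_eq {a b c d : ℝ} (ha : 0 < a) (hb : 0 < b) (hc : 0 < c) (hd : 0 < d) :
    S1 a b - S001 a b c d =
      2 * b / ((2*a*b + 2*a^2 + b^2) *
        (2*c^2*(a + b)*(a + c) + 2*c*d*(b*c + a*(b + c)) + a*b*d^2)) *
      (-(2 * d * (c + d)) * a ^ 3 + (b * (2 * c ^ 2 - d ^ 2) - 2 * c ^ 2 * d) * a ^ 2
        + (b ^ 2 * (c ^ 2 + c * d) + 2 * b * c ^ 3) * a + b ^ 2 * c ^ 3) := by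
  have h₁ : 2*a*b + 2*a^2 + b^2 ≠ 0 := by positivity
  have h₂ : 2*c^2*(a + b)*(a + c) + 2*c*d*(b*c + a*(b + c)) + a*b*d^2 ≠ 0 := by positivity
  rw [S1, S001, div_sub_div _ _ h₁ h₂, div_mul_eq_mul_div]
  congr 1
  ring

theorem switching_threshold_S1_S001 (b c d : ℝ) (hb : 0 < b) (hc : 0 < c) (hd : 0 < d) :
    ∃! g : ℝ, 0 < g ∧ ∀ a : ℝ, 0 < a →
      ((a < g → S1 a b > S001 a b c d) ∧
       (g < a → S1 a b < S001 a b c d) ∧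
       (a = g → S1 a b = S001 a b c d)) := by
  obtain ⟨g, hg, k, hk⟩ := exists_pos_cubic_sign_change
    (A := 2 * d * (c + d)) (B := b * (2 * c ^ 2 - d ^ 2) - 2 * c ^ 2 * d)
    (C := b ^ 2 * (c ^ 2 + c * d) + 2 * b * c ^ 3) (E := b ^ 2 * c ^ 3)
    (by positivity) (by positivity) (by positivity)
  have hdiff : ∀ a : ℝ, 0 < a → ∃ r : ℝ, 0 < r ∧ S1 a b - S001 a b c d = r * (g - a) := by
    intro a ha
    obtain ⟨hka, hfac⟩ := hk a ha
    refine ⟨_, ?_, (S1_sub_S001_eq ha hb hc hd).trans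
      (by rw [hfac, mul_comm (g - a), ← mul_assoc])⟩
    positivity
  have hsign : ∀ a : ℝ, 0 < a →
      ((a < g → S1 a b > S001 a b c d) ∧
       (g < a → S1 a b < S001 a b c d) ∧
       (a = g → S1 a b = S001 a b c d)) := by
    intro a ha
    obtain ⟨r, hr, h⟩ := hdiff a ha
    refine ⟨fun hlt => ?_, fun hlt => ?_, fun heq => ?_⟩
    · exact sub_pos.mp (h ▸ mul_pos hr (sub_pos.mpr hlt))
    · exact sub_neg.mp (h ▸ mul_neg_of_pos_of_neg hr (sub_neg.mpr hlt))
    · exact sub_eq_zero.mp (by rw [h, heq, sub_self, mul_zero])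
  refine ⟨g, ⟨hg, hsign⟩, ?_⟩
  rintro g' ⟨hg', h'⟩
  have heq := (h' g' hg').2.2 rfl
  rcases lt_trichotomy g' g with hlt | h | hgt
  · exact absurd heq ((hsign g' hg').1 hlt).ne'
  · exact h
  · exact absurd heq ((hsign g' hg').2.1 hgt).ne
end

section
/- Fix real numbers b, c, d with 0 < d < b and c > 0, and let f* > 0 and g* > 0 be the unique positive values of a at which, respectively, S0(a) = S001(a) and S1(a) = S001(a) (regarding S0, S1, S001 as functions of a). Then g* < b*c/d < f*; in particular the two switching thresholds satisfy f* > g*. (The switching curves of Theorem 1 straddle the equal-efficiency line lambda_h = mu_h*lambda_l/mu_l.) -/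
/-- A positive root of `p x² + q x - r` lies above every positive point where this is negative. -/
theorem lt_root_of_quadratic_neg {p q r x y : ℝ} (hp : 0 ≤ p) (hr : 0 ≤ r) (hx : 0 < x)
    (hy : 0 < y) (hroot : p * y ^ 2 + q * y - r = 0) (hneg : p * x ^ 2 + q * x - r < 0) :
    x < y := by
  by_contra! h
  have hpos : 0 ≤ (x - y) * (p * (x * y) + r) :=
    mul_nonneg (sub_nonneg.2 h) (by positivity)
  have hmul : (p * x ^ 2 + q * x - r) * y < 0 := mul_neg_of_neg_of_pos hneg hy
  have hcomb : (x - y) * (p * (x * y) + r) = (p * x ^ 2 + q * x - r) * y := by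
    linear_combination -x * hroot
  linarith

/-- A positive root of `-p x³ + q x² + r x + s` lies below every positive point where this is
negative. -/
theorem root_lt_of_cubic_neg {p q r s x y : ℝ} (hp : 0 ≤ p) (hr : 0 ≤ r) (hs : 0 ≤ s)
    (hx : 0 < x) (hy : 0 < y) (hroot : -p * y ^ 3 + q * y ^ 2 + r * y + s = 0)
    (hneg : -p * x ^ 3 + q * x ^ 2 + r * x + s < 0) : y < x := by
  by_contra! h
  have hpos : 0 ≤ (y - x) * (p * (x * y) ^ 2 + r * (x * y) + s * (x + y)) :=
    mul_nonneg (sub_nonneg.2 h) (by positivity)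
  have hmul : (-p * x ^ 3 + q * x ^ 2 + r * x + s) * y ^ 2 < 0 :=
    mul_neg_of_neg_of_pos hneg (by positivity)
  have hcomb : (y - x) * (p * (x * y) ^ 2 + r * (x * y) + s * (x + y))
      = (-p * x ^ 3 + q * x ^ 2 + r * x + s) * y ^ 2 := by
    linear_combination -x ^ 2 * hroot
  linarith

theorem quadratic_eq_zero_of_S0_eq_S001 {a b c d : ℝ} (ha : 0 < a) (hb : 0 < b) (hc : 0 < c)
    (hd : 0 < d) (h : S0 c d = S001 a b c d) :
    2 * d * (c + d) * a ^ 2 + (2 * d * (c + d) ^ 2 - b * (2 * c * d + 2 * c ^ 2 + d ^ 2)) * a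
      - b * c * (d ^ 2 + 4 * c * d + 2 * c ^ 2) = 0 := by
  unfold S0 S001 at h
  rw [div_eq_div_iff (by positivity) (by positivity)] at h
  have hc2 : 2 * c ^ 2 ≠ 0 := by positivity
  apply mul_left_cancel₀ hc2
  linear_combination h

theorem cubic_eq_zero_of_S1_eq_S001 {a b c d : ℝ} (ha : 0 < a) (hb : 0 < b) (hc : 0 < c)
    (hd : 0 < d) (h : S1 a b = S001 a b c d) :
    -(2 * d * (c + d)) * a ^ 3 + (b * (2 * c ^ 2 - d ^ 2) - 2 * c ^ 2 * d) * a ^ 2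
      + (b ^ 2 * c * (c + d) + 2 * b * c ^ 3) * a + b ^ 2 * c ^ 3 = 0 := by
  unfold S1 S001 at h
  rw [div_eq_div_iff (by positivity) (by positivity)] at h
  have hb2 : 2 * b ≠ 0 := by positivity
  apply mul_left_cancel₀ hb2
  linear_combination h

theorem switching_thresholds_straddle_equal_efficiency_line (b c d f g : ℝ)
    (hd : 0 < d) (hdb : d < b) (hc : 0 < c)
    (hf : 0 < f) (hg : 0 < g)
    (hfeq : S0 c d = S001 f b c d)
    (hfuniq : ∀ a : ℝ, 0 < a → S0 c d = S001 a b c d → a = f)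
    (hgeq : S1 g b = S001 g b c d)
    (hguniq : ∀ a : ℝ, 0 < a → S1 a b = S001 a b c d → a = g) :
    g < b*c/d ∧ b*c/d < f := by
  have hb : 0 < b := hd.trans hdb
  have hx : 0 < b * c / d := by positivity
  constructor
  · refine root_lt_of_cubic_neg (by positivity) (by positivity) (by positivity) hx hg
      (cubic_eq_zero_of_S1_eq_S001 hg hb hc hd hgeq) ?_
    have hval : -(2 * d * (c + d)) * (b * c / d) ^ 3
        + (b * (2 * c ^ 2 - d ^ 2) - 2 * c ^ 2 * d) * (b * c / d) ^ 2
        + (b ^ 2 * c * (c + d) + 2 * b * c ^ 3) * (b * c / d) + b ^ 2 * c ^ 3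
        = b ^ 2 * c ^ 3 / d * (d - b) := by
      field_simp
      ring
    rw [hval]
    exact mul_neg_of_pos_of_neg (by positivity) (sub_neg.2 hdb)
  · refine lt_root_of_quadratic_neg (by positivity) (by positivity) hx hf
      (quadratic_eq_zero_of_S0_eq_S001 hf hb hc hd hfeq) ?_
    have hval : 2 * d * (c + d) * (b * c / d) ^ 2
        + (2 * d * (c + d) ^ 2 - b * (2 * c * d + 2 * c ^ 2 + d ^ 2)) * (b * c / d)
        - b * c * (d ^ 2 + 4 * c * d + 2 * c ^ 2) = b * c * d * (d - b) := by
      field_simp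
      ring
    rw [hval]
    exact mul_neg_of_pos_of_neg (by positivity) (sub_neg.2 hdb)
end

section
/- Fix real numbers b, c, d > 0 and define fExpl := (b*(2*c*d + 2*c^2 + d^2) - (4*c*d^2 + 2*c^2*d + 2*d^3) + sqrt(b^2*(8*c^3*d + 8*c^2*d^2 + 4*c*d^3 + 4*c^4 + d^4) + b*(8*c*d*(c + d)*(4*c*d + 2*c^2 + d^2) - 16*c*d^4 - 28*c^2*d^3 - 24*c^3*d^2 - 8*c^4*d - 4*d^5) + (16*c*d^5 + 24*c^2*d^4 + 16*c^3*d^3 + 4*c^4*d^2 + 4*d^6)))/(4*d*(c + d)). Then fExpl > 0, and fExpl is the unique positive real a such that S0(a) = S001(a) (regarding S0 and S001 as functions of a). -/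
noncomputable def fExpl (b c d : ℝ) : ℝ :=
  (b*(2*c*d + 2*c^2 + d^2) - (4*c*d^2 + 2*c^2*d + 2*d^3) +
    Real.sqrt (b^2*(8*c^3*d + 8*c^2*d^2 + 4*c*d^3 + 4*c^4 + d^4) +
      b*(8*c*d*(c + d)*(4*c*d + 2*c^2 + d^2) - 16*c*d^4 - 28*c^2*d^3 - 24*c^3*d^2
          - 8*c^4*d - 4*d^5) +
      (16*c*d^5 + 24*c^2*d^4 + 16*c^3*d^3 + 4*c^4*d^2 + 4*d^6)))/(4*d*(c + d))

/-- For positive rates, equality of the two efficiencies is a quadratic equation in `a`. -/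
lemma S0_eq_S001_iff {a b c d : ℝ} (ha : 0 < a) (hb : 0 < b) (hc : 0 < c) (hd : 0 < d) :
    S0 c d = S001 a b c d ↔
      2*d*(c + d)*(a*a) + (2*d*(c + d)^2 - b*(2*c*d + 2*c^2 + d^2))*a
        + -(b*c*(4*c*d + 2*c^2 + d^2)) = 0 := by
  unfold S0 S001
  rw [div_eq_div_iff (by positivity) (by positivity), ← sub_eq_zero]
  have key : (2*d^2 + 2*c*d)*
        (2*c^2*(a + b)*(a + c) + 2*c*d*(b*c + a*(b + c)) + a*b*d^2)
      - (2*a*b*d^2 + 4*b*c^2*d + 2*a*b*c*d + 2*b*c^2*(a + c))*(2*c*d + 2*c^2 + d^2)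
      = 2*c^2*(2*d*(c + d)*(a*a) + (2*d*(c + d)^2 - b*(2*c*d + 2*c^2 + d^2))*a
        + -(b*c*(4*c*d + 2*c^2 + d^2))) := by ring
  rw [key, mul_eq_zero, or_iff_right (by positivity)]

/-- A quadratic with positive leading and negative constant coefficient has exactly one positive
root, given by the quadratic formula with the positive sign. -/
lemma quadratic_pos_root {p q r : ℝ} (hp : 0 < p) (hr : r < 0) :
    0 < (-q + Real.sqrt (discrim p q r))/(2*p) ∧
      ∀ x : ℝ, 0 < x →
        (p*(x*x) + q*x + r = 0 ↔ x = (-q + Real.sqrt (discrim p q r))/(2*p)) := by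
  have hlt : q^2 < discrim p q r := by
    unfold discrim
    nlinarith [mul_neg_of_pos_of_neg hp hr]
  have hs : |q| < Real.sqrt (discrim p q r) := Real.lt_sqrt_of_sq_lt (by rwa [sq_abs])
  obtain ⟨hs₁, hs₂⟩ := abs_lt.mp hs
  refine ⟨div_pos (by linarith) (by linarith), fun x hx => ?_⟩
  rw [quadratic_eq_zero_iff hp.ne'
    (Real.mul_self_sqrt ((sq_nonneg q).trans hlt.le)).symm]
  refine or_iff_left fun h => ?_
  have : (-q - Real.sqrt (discrim p q r))/(2*p) < 0 :=
    div_neg_of_neg_of_pos (by linarith) (by linarith)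
  linarith

lemma fExpl_eq_quadratic_root (b c d : ℝ) :
    fExpl b c d = (-(2*d*(c + d)^2 - b*(2*c*d + 2*c^2 + d^2)) +
      Real.sqrt (discrim (2*d*(c + d)) (2*d*(c + d)^2 - b*(2*c*d + 2*c^2 + d^2))
        (-(b*c*(4*c*d + 2*c^2 + d^2)))))/(2*(2*d*(c + d))) := by
  unfold fExpl discrim
  congr 1
  · congr 1
    · ring
    · congr 1
      ring
  · ring

theorem fExpl_is_unique_crossing (b c d : ℝ) (hb : 0 < b) (hc : 0 < c) (hd : 0 < d) :
    0 < fExpl b c d ∧ S0 c d = S001 (fExpl b c d) b c d ∧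
      ∀ a : ℝ, 0 < a → S0 c d = S001 a b c d → a = fExpl b c d := by
  have hr : -(b*c*(4*c*d + 2*c^2 + d^2)) < 0 := neg_neg_of_pos (by positivity)
  obtain ⟨hpos, hroot⟩ := quadratic_pos_root
    (q := 2*d*(c + d)^2 - b*(2*c*d + 2*c^2 + d^2)) (show 0 < 2*d*(c + d) by positivity) hr
  rw [← fExpl_eq_quadratic_root] at hpos hroot
  exact ⟨hpos, (S0_eq_S001_iff hpos hb hc hd).mpr ((hroot _ hpos).mpr rfl),
    fun a ha h => (hroot a ha).mp ((S0_eq_S001_iff ha hb hc hd).mp h)⟩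
end

section
/- Fix real numbers c, d > 0 and define, for b > 0, fExpl(b) := (b*(2*c*d + 2*c^2 + d^2) - (4*c*d^2 + 2*c^2*d + 2*d^3) + sqrt(b^2*(8*c^3*d + 8*c^2*d^2 + 4*c*d^3 + 4*c^4 + d^4) + b*(8*c*d*(c + d)*(4*c*d + 2*c^2 + d^2) - 16*c*d^4 - 28*c^2*d^3 - 24*c^3*d^2 - 8*c^4*d - 4*d^5) + (16*c*d^5 + 24*c^2*d^4 + 16*c^3*d^3 + 4*c^4*d^2 + 4*d^6)))/(4*d*(c + d)). Then fExpl(b)/b tends to ((2*c*d + 2*c^2 + d^2) + sqrt(8*c^3*d + 8*c^2*d^2 + 4*c*d^3 + 4*c^4 + d^4))/(4*d*(c + d)) as b tends to infinity; that is, the switching curve separating the regions where strategies 0*|0 and 00|1 are better is asymptotically linear in mu_h. -/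
theorem tendsto_affine_add_sqrt_quadratic_div (p q A B C k : ℝ) :
    Filter.Tendsto (fun b : ℝ => (b * p - q + Real.sqrt (b ^ 2 * A + b * B + C)) / k / b)
      Filter.atTop (nhds ((p + Real.sqrt A) / k)) := by
  have hinv : Filter.Tendsto (fun b : ℝ => b⁻¹) Filter.atTop (nhds 0) := tendsto_inv_atTop_zero
  have hcont : Continuous fun x : ℝ => (p - q * x + Real.sqrt (A + B * x + C * x ^ 2)) / k := by
    fun_prop
  have hlim := (hcont.tendsto 0).comp hinv
  simp only [mul_zero, sub_zero, add_zero, ne_eq, OfNat.ofNat_ne_zero, not_false_eq_true,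
    zero_pow] at hlim
  refine hlim.congr' ?_
  filter_upwards [Filter.eventually_gt_atTop 0] with b hb
  have hsqrt : Real.sqrt (b ^ 2 * A + b * B + C) =
      b * Real.sqrt (A + B * b⁻¹ + C * b⁻¹ ^ 2) := by
    rw [show b ^ 2 * A + b * B + C = b ^ 2 * (A + B * b⁻¹ + C * b⁻¹ ^ 2) by field_simp,
      Real.sqrt_mul (sq_nonneg b), Real.sqrt_sq hb.le]
  rw [Function.comp_apply, hsqrt, div_right_comm]
  congr 1
  field_simp

theorem switching_curve_asymptotically_linear (c d : ℝ) (hc : 0 < c) (hd : 0 < d) :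
    Filter.Tendsto (fun b : ℝ => fExpl b c d / b) Filter.atTop
      (nhds (((2*c*d + 2*c^2 + d^2) +
        Real.sqrt (8*c^3*d + 8*c^2*d^2 + 4*c*d^3 + 4*c^4 + d^4))/(4*d*(c + d)))) :=
  tendsto_affine_add_sqrt_quadratic_div _ _ _ _ _ _
end

section
/- Let a, b, c, d be real numbers with a, b, c, d > 0, and define delta1 := -2*a^2*c*d + a*(2*b*c^2 - 3*b*c*d - d^2*(b + 2*c) - 2*c^2*d) + 2*b*c^3 + 2*b^2*c^2 + 3*b*c^2*d + b^2*c*d. Then S101 > S001 if and only if delta1 > 0 (and S101 = S001 if and only if delta1 = 0). -/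
/-- The difference of the two efficiencies is a positive multiple of `delta1`. -/
theorem S101_sub_S001 (a b c d : ℝ) (ha : 0 < a) (hb : 0 < b) (hc : 0 < c) (hd : 0 < d) :
    S101 a b c d - S001 a b c d =
      (a*b*d / (((a + b)*((c + d)*(b + c) + a*c)) *
        (2*c^2*(a + b)*(a + c) + 2*c*d*(b*c + a*(b + c)) + a*b*d^2))) *
      (-2*a^2*c*d + a*(2*b*c^2 - 3*b*c*d - d^2*(b + 2*c) - 2*c^2*d)
        + 2*b*c^3 + 2*b^2*c^2 + 3*b*c^2*d + b^2*c*d) := by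
  have h₁ : (a + b)*((c + d)*(b + c) + a*c) ≠ 0 := by positivity
  have h₂ : 2*c^2*(a + b)*(a + c) + 2*c*d*(b*c + a*(b + c)) + a*b*d^2 ≠ 0 := by positivity
  rw [S101, S001, div_sub_div _ _ h₁ h₂, div_mul_eq_mul_div]
  congr 1
  ring

theorem S101_vs_S001_sign (a b c d : ℝ) (ha : 0 < a) (hb : 0 < b) (hc : 0 < c) (hd : 0 < d) :
    let delta1 : ℝ := -2*a^2*c*d + a*(2*b*c^2 - 3*b*c*d - d^2*(b + 2*c) - 2*c^2*d)
      + 2*b*c^3 + 2*b^2*c^2 + 3*b*c^2*d + b^2*c*d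
    (S101 a b c d > S001 a b c d ↔ delta1 > 0) ∧
    (S101 a b c d = S001 a b c d ↔ delta1 = 0) := by
  intro delta1
  have h := S101_sub_S001 a b c d ha hb hc hd
  have hk : 0 < a*b*d / (((a + b)*((c + d)*(b + c) + a*c)) *
      (2*c^2*(a + b)*(a + c) + 2*c*d*(b*c + a*(b + c)) + a*b*d^2)) := by positivity
  constructor
  · rw [gt_iff_lt, ← sub_pos, h]
    exact mul_pos_iff_of_pos_left hk
  · rw [← sub_eq_zero, h]
    exact mul_eq_zero_iff_left hk.ne'
end

section
/- Let a, b, c, d be real numbers with a, b, c, d > 0, and define delta2 := 2*a^3*d + a^2*(4*b*d - 2*b*c + 2*c*d) - a*(2*b*c^2 + 3*b^2*c - b^2*d) - b^3*c - b^2*c^2. Then S101 > S1 if and only if delta2 > 0 (and S101 = S1 if and only if delta2 = 0). -/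
/-- The difference of the two efficiencies, as a positive multiple of a polynomial. -/
theorem S101_sub_S1 (a b c d : ℝ) (ha : 0 < a) (hb : 0 < b) (hc : 0 < c) (hd : 0 < d) :
    S101 a b c d - S1 a b =
      b / ((a + b)*((c + d)*(b + c) + a*c) * (2*a*b + 2*a^2 + b^2)) *
        (2*a^3*d + a^2*(4*b*d - 2*b*c + 2*c*d)
          - a*(2*b*c^2 + 3*b^2*c - b^2*d) - b^3*c - b^2*c^2) := by
  have h101 : (a + b)*((c + d)*(b + c) + a*c) ≠ 0 := by positivity
  have h1 : 2*a*b + 2*a^2 + b^2 ≠ 0 := by positivity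
  rw [S101, S1, div_sub_div _ _ h101 h1, div_mul_eq_mul_div]
  congr 1
  ring

theorem S101_vs_S1_sign (a b c d : ℝ) (ha : 0 < a) (hb : 0 < b) (hc : 0 < c) (hd : 0 < d) :
    let delta2 : ℝ := 2*a^3*d + a^2*(4*b*d - 2*b*c + 2*c*d)
      - a*(2*b*c^2 + 3*b^2*c - b^2*d) - b^3*c - b^2*c^2
    (S101 a b c d > S1 a b ↔ delta2 > 0) ∧
    (S101 a b c d = S1 a b ↔ delta2 = 0) := by
  intro delta2
  have hdiff : S101 a b c d - S1 a b =
      b / ((a + b)*((c + d)*(b + c) + a*c) * (2*a*b + 2*a^2 + b^2)) * delta2 :=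
    S101_sub_S1 a b c d ha hb hc hd
  have hpos : 0 < b / ((a + b)*((c + d)*(b + c) + a*c) * (2*a*b + 2*a^2 + b^2)) := by
    positivity
  constructor
  · rw [gt_iff_lt, ← sub_pos, hdiff, mul_pos_iff_of_pos_left hpos]
  · rw [← sub_eq_zero, hdiff, mul_eq_zero_iff_left hpos.ne']
end

section
/- Let b, c, d be real numbers with 0 < d < b and c > 0, and define lamTilde := (2*c^2*(b - d) - c*d*(3*b + 2*d) - b*d^2 + sqrt(8*b*c^2*d*(2*c*(b + c) + d*(b + 3*c)) + (2*c^2*(d - b) + c*d*(3*b + 2*d) + b*d^2)^2))/(4*c*d). Then lamTilde > 0, at a = lamTilde one has S101 = S001, and at a = lamTilde one has S1 > S001. (At the unique positive crossing point of S101 and S001, strategy *1|1 is strictly better than 00|1.) -/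
noncomputable def lamTilde (b c d : ℝ) : ℝ :=
  (2*c^2*(b - d) - c*d*(3*b + 2*d) - b*d^2 +
    Real.sqrt (8*b*c^2*d*(2*c*(b + c) + d*(b + 3*c)) +
      (2*c^2*(d - b) + c*d*(3*b + 2*d) + b*d^2)^2))/(4*c*d)

/-- The quadratic in `a` whose unique positive root is `lamTilde`. -/
def crossingQuadratic (b c d a : ℝ) : ℝ :=
  2*c*d*a^2 + (2*c^2*(d - b) + c*d*(3*b + 2*d) + b*d^2)*a - b*c*(2*c*(b + c) + d*(b + 3*c))

lemma lamTilde_pos {b c d : ℝ} (hb : 0 < b) (hc : 0 < c) (hd : 0 < d) : 0 < lamTilde b c d := by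
  unfold lamTilde
  have h : |2*c^2*(d - b) + c*d*(3*b + 2*d) + b*d^2| <
      Real.sqrt (8*b*c^2*d*(2*c*(b + c) + d*(b + 3*c)) +
        (2*c^2*(d - b) + c*d*(3*b + 2*d) + b*d^2)^2) := by
    rw [← Real.sqrt_sq_eq_abs]
    apply Real.sqrt_lt_sqrt (sq_nonneg _)
    have : 0 < 8*b*c^2*d*(2*c*(b + c) + d*(b + 3*c)) := by positivity
    linarith
  have h' := (le_abs_self _).trans_lt h
  exact div_pos (by linarith) (by positivity)

lemma crossingQuadratic_lamTilde {b c d : ℝ} (hb : 0 < b) (hc : 0 < c) (hd : 0 < d) :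
    crossingQuadratic b c d (lamTilde b c d) = 0 := by
  have hs : 0 ≤ 8*b*c^2*d*(2*c*(b + c) + d*(b + 3*c)) +
      (2*c^2*(d - b) + c*d*(3*b + 2*d) + b*d^2)^2 := by positivity
  have h := Real.sq_sqrt hs
  unfold crossingQuadratic lamTilde
  set s := Real.sqrt (8*b*c^2*d*(2*c*(b + c) + d*(b + 3*c)) +
      (2*c^2*(d - b) + c*d*(3*b + 2*d) + b*d^2)^2)
  field_simp
  linear_combination 2 * h

lemma S101_eq_S001_of_crossingQuadratic_eq_zero {a b c d : ℝ} (ha : 0 < a) (hb : 0 < b)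
    (hc : 0 < c) (hd : 0 < d) (h : crossingQuadratic b c d a = 0) :
    S101 a b c d = S001 a b c d := by
  unfold crossingQuadratic at h
  unfold S101 S001
  rw [div_eq_div_iff (by positivity) (by positivity)]
  linear_combination (-b*d*a) * h

/-- The quadratic increases through its positive root, so a point where it is negative lies to
the left of that root. -/
lemma lt_of_crossingQuadratic_lt {a b c d x y : ℝ} (hb : 0 < b) (hc : 0 < c) (hd : 0 < d)
    (hx : 0 < x) (hy : 0 < y) (h : crossingQuadratic b c d x < crossingQuadratic b c d y)
    (ha : a = x ∨ a = y) (h0 : crossingQuadratic b c d a = 0) : x < y := by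
  unfold crossingQuadratic at h h0
  by_contra! hxy
  have hC : 0 < b*c*(2*c*(b + c) + d*(b + 3*c)) := by positivity
  have hA : 0 < 2*c*d := by positivity
  set A := 2*c*d
  set B := 2*c^2*(d - b) + c*d*(3*b + 2*d) + b*d^2
  set C := b*c*(2*c*(b + c) + d*(b + 3*c))
  have hslope : 0 < A*a + B := by
    rcases ha with rfl | rfl
    · exact pos_of_mul_pos_left (by linarith : 0 < (A*a + B)*a) hx.le
    · exact pos_of_mul_pos_left (by linarith : 0 < (A*a + B)*a) hy.le
  have hmul : 0 ≤ (x - y)*(A*(x + y) + B) := by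
    refine mul_nonneg (by linarith) ?_
    rcases ha with rfl | rfl <;> nlinarith
  linarith

lemma S001_lt_S1_of_crossingQuadratic_eq_zero {a b c d : ℝ} (ha : 0 < a) (hc : 0 < c)
    (hd : 0 < d) (hdb : d < b) (h : crossingQuadratic b c d a = 0) :
    S001 a b c d < S1 a b := by
  have hb : 0 < b := hd.trans hdb
  have hbd : 0 < b - d := sub_pos.2 hdb
  have h1 : c < a := by
    refine lt_of_crossingQuadratic_lt hb hc hd hc ha ?_ (Or.inr rfl) h
    rw [h]
    have : crossingQuadratic b c d c = -((b - d)*(4*c^3 + 2*c^2*(b + d) + b*c*d)) := by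
      unfold crossingQuadratic; ring
    rw [this, neg_lt_zero]
    positivity
  have h2 : a < b*c/d := by
    refine lt_of_crossingQuadratic_lt hb hc hd ha (by positivity) ?_ (Or.inl rfl) h
    rw [h]
    have : crossingQuadratic b c d (b*c/d) = b*c^2*(b - d) := by
      unfold crossingQuadratic; field_simp; ring
    rw [this]
    positivity
  have h3 : b*c/(2*d) < a := by
    refine lt_of_crossingQuadratic_lt hb hc hd (by positivity) ha ?_ (Or.inr rfl) h
    rw [h]
    have : crossingQuadratic b c d (b*c/(2*d)) =
        -(b^2*c^3/(2*d) + b*c^3 + b^2*c^2/2 + 2*b*c^2*d + b^2*c*d/2) := by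
      unfold crossingQuadratic; field_simp; ring
    rw [this, neg_lt_zero]
    positivity
  rw [lt_div_iff₀ hd] at h2
  rw [div_lt_iff₀ (by positivity)] at h3
  have hpos : 0 < (a - c)*(a*(2*d) - b*c)*(b*c - a*d) :=
    mul_pos (mul_pos (sub_pos.2 h1) (sub_pos.2 h3)) (sub_pos.2 h2)
  unfold crossingQuadratic at h
  unfold S001 S1
  rw [div_lt_div_iff₀ (by positivity) (by positivity), ← sub_pos]
  have key : (2*b^2 + 2*a*b)*(2*c^2*(a + b)*(a + c) + 2*c*d*(b*c + a*(b + c)) + a*b*d^2) -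
      (2*a*b*d^2 + 4*b*c^2*d + 2*a*b*c*d + 2*b*c^2*(a + c))*(2*a*b + 2*a^2 + b^2) =
      2*b*((a - c)*(a*(2*d) - b*c)*(b*c - a*d)) := by
    linear_combination (-2*b*a) * h
  rw [key]
  positivity

theorem S1_beats_S001_at_crossing (b c d : ℝ) (hd : 0 < d) (hdb : d < b) (hc : 0 < c) :
    0 < lamTilde b c d ∧
    S101 (lamTilde b c d) b c d = S001 (lamTilde b c d) b c d ∧
    S1 (lamTilde b c d) b > S001 (lamTilde b c d) b c d := by
  have hb : 0 < b := hd.trans hdb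
  have ha := lamTilde_pos hb hc hd
  have hq := crossingQuadratic_lamTilde hb hc hd
  exact ⟨ha, S101_eq_S001_of_crossingQuadratic_eq_zero ha hb hc hd hq,
    S001_lt_S1_of_crossingQuadratic_eq_zero ha hc hd hdb hq⟩
end

section
/- For all real numbers b, c, d the following polynomial identity holds: E1^2 - P^2*R = 16*b^2*c^7*(b - d)^2*(2*c + d)*(b + 2*c)*(c^2*(b + 2*d) + c*d*(b + 4*d) + b*d^2), where E1 := d^5*(12*b*c^2 + 6*b^2*c + b^3 + 8*c^3) + d^4*(68*b*c^3 + 44*b^2*c^2 + 9*b^3*c + 32*c^4) + d^3*(140*b*c^4 + 120*b^2*c^3 + 30*b^3*c^2 + 40*c^5) + d^2*(116*b*c^5 + 132*b^2*c^4 + 39*b^3*c^3 + 16*c^6) + d*(24*b*c^6 + 38*b^2*c^5 + 11*b^3*c^4) + 8*b^2*c^6 + 6*b^3*c^5, P := b*c^3*(b + 4*c) + 2*c^2*d*(11*b*c + 5*b^2 + 4*c^2) + 6*c*d^2*(b + c)*(b + 2*c) + d^3*(b + 2*c)^2, and R := 8*b*c^2*d*(2*c*(b + c) + d*(b + 3*c))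 + (2*c^2*(d - b) + c*d*(3*b + 2*d) + b*d^2)^2. Consequently, for b, c, d > 0 with b different from d, one has E1 > P*sqrt(R). -/
noncomputable def E1 (b c d : ℝ) : ℝ :=
  d^5*(12*b*c^2 + 6*b^2*c + b^3 + 8*c^3) + d^4*(68*b*c^3 + 44*b^2*c^2 + 9*b^3*c + 32*c^4)
  + d^3*(140*b*c^4 + 120*b^2*c^3 + 30*b^3*c^2 + 40*c^5)
  + d^2*(116*b*c^5 + 132*b^2*c^4 + 39*b^3*c^3 + 16*c^6)
  + d*(24*b*c^6 + 38*b^2*c^5 + 11*b^3*c^4) + 8*b^2*c^6 + 6*b^3*c^5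

noncomputable def P (b c d : ℝ) : ℝ :=
  b*c^3*(b + 4*c) + 2*c^2*d*(11*b*c + 5*b^2 + 4*c^2) + 6*c*d^2*(b + c)*(b + 2*c)
  + d^3*(b + 2*c)^2

noncomputable def R (b c d : ℝ) : ℝ :=
  8*b*c^2*d*(2*c*(b + c) + d*(b + 3*c)) + (2*c^2*(d - b) + c*d*(3*b + 2*d) + b*d^2)^2

theorem key_algebraic_identity :
    (∀ b c d : ℝ, E1 b c d ^ 2 - P b c d ^ 2 * R b c d =
      16*b^2*c^7*(b - d)^2*(2*c + d)*(b + 2*c)*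
        (c^2*(b + 2*d) + c*d*(b + 4*d) + b*d^2)) ∧
    (∀ b c d : ℝ, 0 < b → 0 < c → 0 < d → b ≠ d →
      E1 b c d > P b c d * Real.sqrt (R b c d)) := by
  have key : ∀ b c d : ℝ, E1 b c d ^ 2 - P b c d ^ 2 * R b c d =
      16*b^2*c^7*(b - d)^2*(2*c + d)*(b + 2*c)*
        (c^2*(b + 2*d) + c*d*(b + 4*d) + b*d^2) := by
    intro b c d
    unfold E1 P R
    ring
  refine ⟨key, fun b c d hb hc hd hbd => ?_⟩
  have hE : 0 < E1 b c d := by unfold E1; positivity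
  have hR : 0 ≤ R b c d := by unfold R; positivity
  have hsq : 0 < (b - d) ^ 2 := sq_pos_of_ne_zero (sub_ne_zero.mpr hbd)
  have hpos : 0 < E1 b c d ^ 2 - P b c d ^ 2 * R b c d := by
    rw [key]
    positivity
  refine lt_of_pow_lt_pow_left₀ 2 hE.le ?_
  rw [mul_pow, Real.sq_sqrt hR]
  linarith
end

section
/- Let b, c, d be real numbers with 0 < d < b and c > 0, and set a = b*c/d. Then S100 < S0 and S100 < S101. (At the equal-efficiency line, strategy 10|0 is strictly worse than both 0*|0 and 10|1.) -/
/-- On the line `a = b * c / d`, in the scaled variables `k = c / d` and `t = b / d`. -/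
theorem S100_scaled {k t d : ℝ} (hk : 0 < k) (ht : 0 < t) (hd : 0 < d) :
    S100 (t * d * k) (t * d) (k * d) d =
      ((t + 1) * (k ^ 2 + 2 * k) + 2) / ((k + 1) * ((t + 1) * (k ^ 2 + k) + 1)) := by
  unfold S100
  rw [div_eq_div_iff (by positivity) (by positivity)]
  ring

theorem S101_scaled {k t d : ℝ} (hk : 0 < k) (ht : 0 < t) (hd : 0 < d) :
    S101 (t * d * k) (t * d) (k * d) d =
      (t * (k ^ 2 + 2 * k + 2) + k ^ 2 + 2 * k) /
        ((k + 1) * (t * (k ^ 2 + k + 1) + k ^ 2 + k)) := by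
  unfold S101
  rw [div_eq_div_iff (by positivity) (by positivity)]
  ring

theorem S0_scaled {k d : ℝ} (hk : 0 < k) (hd : 0 < d) :
    S0 (k * d) d = 2 * (k + 1) / (2 * k ^ 2 + 2 * k + 1) := by
  unfold S0
  rw [div_eq_div_iff (by positivity) (by positivity)]
  ring

theorem S100_worse_on_equal_efficiency_line (b c d : ℝ)
    (hd : 0 < d) (hdb : d < b) (hc : 0 < c) :
    S100 (b*c/d) b c d < S0 c d ∧ S100 (b*c/d) b c d < S101 (b*c/d) b c d := by
  obtain ⟨k, hk, rfl⟩ : ∃ k, 0 < k ∧ c = k * d := ⟨c / d, by positivity, by field_simp⟩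
  obtain ⟨t, ht, rfl⟩ : ∃ t, 1 < t ∧ b = t * d :=
    ⟨b / d, (one_lt_div hd).2 hdb, by field_simp⟩
  have ht0 : 0 < t := one_pos.trans ht
  have ha : t * d * (k * d) / d = t * d * k := by field_simp
  rw [ha, S100_scaled hk ht0 hd, S101_scaled hk ht0 hd, S0_scaled hk hd]
  constructor
  · rw [div_lt_div_iff₀ (by positivity) (by positivity)]
    have h : 0 < k ^ 2 * (t - 1) := mul_pos (by positivity) (sub_pos.2 ht)
    linear_combination h
  · rw [div_lt_div_iff₀ (by positivity) (by positivity)]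
    have h : 0 < (k + 1) * (k ^ 2 * ((t - 1) * (t + 1))) :=
      mul_pos (by positivity) (mul_pos (by positivity) (mul_pos (sub_pos.2 ht) (by positivity)))
    linear_combination h
end

section
/- Let b, c, d be real numbers with 0 < d < b and c > 0, and set a = b*c/d. Then S110 < S100 and S110 < S1. (At the equal-efficiency line, strategy 11|0 is strictly worse than both 10|0 and *1|1.) -/
/-- `S1` on the line `a = k * b`. -/
lemma S1_mul_left {b k : ℝ} (hb : 0 < b) (hk : 0 < k) :
    S1 (k * b) b = 2 * (1 + k) / (1 + 2 * k + 2 * k ^ 2) := by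
  unfold S1
  rw [div_eq_div_iff (by positivity) (by positivity)]
  ring

/-- `S100` on the line `a = k * b`, `c = k * d`. -/
lemma S100_mul_left {b d k : ℝ} (hb : 0 < b) (hd : 0 < d) (hk : 0 < k) :
    S100 (k * b) b (k * d) d =
      (k * (2 + k) * b + (2 + 2 * k + k ^ 2) * d) /
        ((k + 1) * (k * (k + 1) * b + (k ^ 2 + k + 1) * d)) := by
  unfold S100
  rw [div_eq_div_iff (by positivity) (by positivity)]
  ring

/-- `S110` on the line `a = k * b`, `c = k * d`. -/
lemma S110_mul_left {b d k : ℝ} (hb : 0 < b) (hd : 0 < d) (hk : 0 < k) :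
    S110 (k * b) b (k * d) d =
      (2 * k * (2 + k) * b + (2 + 2 * k + 2 * k ^ 2) * d) /
        (2 * k * (k + 1) ^ 2 * b + (2 * k ^ 3 + 2 * k ^ 2 + 2 * k + 1) * d) := by
  unfold S110
  rw [div_eq_div_iff (by positivity) (by positivity)]
  ring

theorem S110_worse_on_equal_efficiency_line (b c d : ℝ)
    (hd : 0 < d) (hdb : d < b) (hc : 0 < c) :
    S110 (b*c/d) b c d < S100 (b*c/d) b c d ∧ S110 (b*c/d) b c d < S1 (b*c/d) b := by
  obtain ⟨k, hk, rfl⟩ : ∃ k, 0 < k ∧ c = k * d :=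
    ⟨c / d, div_pos hc hd, (div_mul_cancel₀ c hd.ne').symm⟩
  have hb : 0 < b := hd.trans hdb
  have ha : b * (k * d) / d = k * b := by field_simp
  have hbd : 0 < b - d := sub_pos.2 hdb
  rw [ha, S110_mul_left hb hd hk, S100_mul_left hb hd hk, S1_mul_left hb hk]
  constructor
  · rw [div_lt_div_iff₀ (by positivity) (by positivity)]
    have h : 0 < k ^ 2 * d * (b - d) := by positivity
    linear_combination h
  · rw [div_lt_div_iff₀ (by positivity) (by positivity)]
    have h : 0 < 2 * k ^ 2 * (b - d) := by positivity
    linear_combination h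
end

section
/- Let a, b, c, d > 0 be real numbers and let Q be the 5x5 real matrix, indexed by the states (0,0), (0,1), (1,0), (1,1), (2,0), with rows Q = ![![-2*c, 0, 2*c, 0, 0], ![0, -(a+c), a, c, 0], ![d, 0, -(c+d), 0, c], ![0, d, 0, -(a+d), a], ![0, 0, 0, b, -b]] (the generator of the two-user system under strategy 00|1). Let D := 2*c^2*(a+b)*(a+c) + 2*c*d*(b*c + a*(b+c)) + a*b*d^2 and let pi be the row vector (a*b*d^2/D, 2*b*c^2*d/D, 2*a*b*c*d/D, 2*b*c^2*(a+c)/D, 2*a*c^2*(a+c+d)/D). Then every entry of pi is positive, the entries of pi sum to 1, and pi * Q = 0 (pi is the stationary distribution). -/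
open Matrix

theorem stationary_distribution_001 (a b c d : ℝ)
    (ha : 0 < a) (hb : 0 < b) (hc : 0 < c) (hd : 0 < d) :
    let Q : Matrix (Fin 5) (Fin 5) ℝ :=
      ![![-(2*c), 0, 2*c, 0, 0],
        ![0, -(a+c), a, c, 0],
        ![d, 0, -(c+d), 0, c],
        ![0, d, 0, -(a+d), a],
        ![0, 0, 0, b, -b]]
    let D : ℝ := 2*c^2*(a+b)*(a+c) + 2*c*d*(b*c + a*(b+c)) + a*b*d^2
    let pi : Fin 5 → ℝ :=
      ![a*b*d^2/D, 2*b*c^2*d/D, 2*a*b*c*d/D, 2*b*c^2*(a+c)/D, 2*a*c^2*(a+c+d)/D]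
    (∀ i, 0 < pi i) ∧ (∑ i, pi i) = 1 ∧ pi ᵥ* Q = 0 := by
  intro Q D pi
  have hD : 0 < D := by positivity
  refine ⟨fun i => ?_, ?_, ?_⟩
  · fin_cases i <;> simp only [pi] <;> simp <;> positivity
  · simp only [pi, Fin.sum_univ_five]
    simp only [Matrix.cons_val]
    simp only [← add_div]
    rw [div_eq_one_iff_eq hD.ne']
    simp only [D]
    ring
  · ext j
    fin_cases j <;>
      simp [pi, Q, Matrix.vecMul, dotProduct, Fin.sum_univ_five, -mul_neg, -neg_add_rev] <;> ring
end

section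
/- Let a, b, c, d > 0 be real numbers and let Q be the 5x5 real matrix, indexed by the states (0,1), (0,2), (1,0), (1,1), (2,0), with rows Q = ![![-(a+c), 0, a, c, 0], ![0, -2*a, 0, 2*a, 0], ![b, 0, -(b+c), 0, c], ![0, b, 0, -(a+b), a], ![0, 0, d, 0, -d]] (the generator of the two-user system under strategy 11|0). Let D := 2*a^3*(c+d) + 2*a^2*(c+d)*(b+c) + 2*a*b*c*d + b^2*c*d and let pi be the row vector (2*a^2*b*d/D, b^2*c*d/D, 2*a^2*d*(a+c)/D, 2*a*b*c*d/D, 2*a^2*c*(a+b+c)/D). Then every entry of pi is positive, the entries of pi sum to 1, and pi * Q = 0 (pi is the stationary distribution). -/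
open Matrix

theorem stationary_distribution_110 (a b c d : ℝ)
    (ha : 0 < a) (hb : 0 < b) (hc : 0 < c) (hd : 0 < d) :
    let Q : Matrix (Fin 5) (Fin 5) ℝ :=
      ![![-(a+c), 0, a, c, 0],
        ![0, -(2*a), 0, 2*a, 0],
        ![b, 0, -(b+c), 0, c],
        ![0, b, 0, -(a+b), a],
        ![0, 0, d, 0, -d]]
    let D : ℝ := 2*a^3*(c+d) + 2*a^2*(c+d)*(b+c) + 2*a*b*c*d + b^2*c*d
    let pi : Fin 5 → ℝ :=
      ![2*a^2*b*d/D, b^2*c*d/D, 2*a^2*d*(a+c)/D, 2*a*b*c*d/D, 2*a^2*c*(a+b+c)/D]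
    (∀ i, 0 < pi i) ∧ (∑ i, pi i) = 1 ∧ pi ᵥ* Q = 0 := by 
  intro Q D pi
  have hD : 0 < D := by positivity
  refine ⟨?_, ?_, ?_⟩
  · intro i
    fin_cases i <;> simp [pi] <;> positivity
  · simp only [pi, Fin.sum_univ_five, Matrix.cons_val]
    field_simp
    simp only [D]
    ring
  · ext j
    fin_cases j <;> simp [pi, Q, Matrix.vecMul, dotProduct, Fin.sum_univ_five] <;> ring
end

section
/- Let a, b, c, d > 0 be real numbers and let Q be the 4x4 real matrix, indexed by the states (0,1), (1,0), (1,1), (2,0), with rows Q = ![![-(a+c), a, c, 0], ![b, -(b+c), 0, c], ![d, 0, -(a+d), a], ![0, 0, b, -b]] (the generator of the two-user system under strategy 10|1). Let D := (a+b)*((c+d)*(b+c) + a*c) and let pi be the row vector (b*d*(b+c)/D, a*b*d/D, b*c*(a+b+c)/D, a*c*(a+b+c+d)/D). Then every entry of pi is positive, the entries of pi sum to 1, and pi * Q = 0 (pi is the stationary distribution). -/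
open Matrix

theorem stationary_distribution_101 (a b c d : ℝ)
    (ha : 0 < a) (hb : 0 < b) (hc : 0 < c) (hd : 0 < d) :
    let Q : Matrix (Fin 4) (Fin 4) ℝ :=
      ![![-(a+c), a, c, 0],
        ![b, -(b+c), 0, c],
        ![d, 0, -(a+d), a],
        ![0, 0, b, -b]]
    let D : ℝ := (a+b)*((c+d)*(b+c) + a*c)
    let pi : Fin 4 → ℝ :=
      ![b*d*(b+c)/D, a*b*d/D, b*c*(a+b+c)/D, a*c*(a+b+c+d)/D]
    (∀ i, 0 < pi i) ∧ (∑ i, pi i) = 1 ∧ pi ᵥ* Q = 0 := by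
  intro Q D pi
  have hD : 0 < D := by positivity
  refine ⟨fun i => ?_, ?_, ?_⟩
  · fin_cases i <;> simp only [pi] <;> dsimp <;> positivity
  · simp only [pi, Fin.sum_univ_four]
    dsimp
    rw [← add_div, ← add_div, ← add_div, div_eq_one_iff_eq hD.ne']
    ring
  · ext j
    fin_cases j <;> simp [pi, Q, vecMul, dotProduct, Fin.sum_univ_four] <;> ring
end
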